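/- arXiv:2303.04380 — 8 statements merged into one kernel-verified Lean document; each statement's English description precedes it below -/
import Mathlib

section
/- For all w, w', w'' ∈ ℂ, the matrix product H(w'')·T·H(w')·T·H(w)·T equals [[exp((w+w'+w'')/2), −b],[0, exp(−(w+w'+w'')/2)]], where b = exp((w+w'+w'')/2) + exp((−w+w'+w'')/2) + exp((−w−w'+w'')/2). (This is the general form of the holonomy around a boundary hexagon with all medium edges oriented the same way.) -/
open Matrix

/-- The matrix assigned to medium edges. -/
def T : Matrix (Fin 2) (Fin 2) ℂ := !![1, -1; 0, 1]

/-- The matrix assigned to short edges, for a flattening value `w`. -/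
noncomputable def H (w : ℂ) : Matrix (Fin 2) (Fin 2) ℂ :=
  !![Complex.exp (w / 2), 0; 0, Complex.exp (-w / 2)]

/-- The general form of the holonomy around a boundary hexagon with all medium edges
oriented the same way. -/
theorem boundary_hexagon_holonomy (w w' w'' : ℂ) :
    H w'' * T * H w' * T * H w * T =
      !![Complex.exp ((w + w' + w'') / 2),
          -(Complex.exp ((w + w' + w'') / 2) + Complex.exp ((-w + w' + w'') / 2) +
            Complex.exp ((-w - w' + w'') / 2));
         0, Complex.exp (-((w + w' + w'') / 2))] := by
  have hsum : Complex.exp ((w + w' + w'') / 2) =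
      Complex.exp (w'' / 2) * Complex.exp (w' / 2) * Complex.exp (w / 2) := by
    simp only [← Complex.exp_add]; ring_nf
  have hneg : Complex.exp ((-w + w' + w'') / 2) =
      Complex.exp (w'' / 2) * Complex.exp (w' / 2) * Complex.exp (-w / 2) := by
    simp only [← Complex.exp_add]; ring_nf
  have hneg' : Complex.exp ((-w - w' + w'') / 2) =
      Complex.exp (w'' / 2) * Complex.exp (-w' / 2) * Complex.exp (-w / 2) := by
    simp only [← Complex.exp_add]; ring_nf
  have hinv : Complex.exp (-((w + w' + w'') / 2)) =
      Complex.exp (-w'' / 2) * Complex.exp (-w' / 2) * Complex.exp (-w / 2) := by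
    simp only [← Complex.exp_add]; ring_nf
  rw [hsum, hneg, hneg', hinv]
  ext i j
  fin_cases i <;> fin_cases j <;> simp [H, T, Matrix.mul_apply, Fin.sum_univ_two]
  ring
end

section
/- For all w, w', w'' ∈ ℂ, the matrix product H(w'')·T⁻¹·H(w')·T·H(w)·T equals [[exp((w+w'+w'')/2), −b],[0, exp(−(w+w'+w'')/2)]], where b = exp((w+w'+w'')/2) + exp((−w+w'+w'')/2) − exp((−w−w'+w'')/2), and T⁻¹ = [[1,1],[0,1]]. (This is the general form of the holonomy around a boundary hexagon in which one medium edge is traversed against its orientation.) -/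
open Matrix

theorem T_inv : T⁻¹ = !![1, 1; 0, 1] := by
  refine Matrix.inv_eq_right_inv ?_
  simp [T, Matrix.one_fin_two]

/-- The general form of the holonomy around a boundary hexagon in which one medium edge is
traversed against its orientation.  Here `T⁻¹ = !![1, 1; 0, 1]`. -/
theorem boundary_hexagon_holonomy_reversed (w w' w'' : ℂ) :
    T⁻¹ = !![1, 1; 0, 1] ∧
    H w'' * T⁻¹ * H w' * T * H w * T =
      !![Complex.exp ((w + w' + w'') / 2),
          -(Complex.exp ((w + w' + w'') / 2) + Complex.exp ((-w + w' + w'') / 2) -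
            Complex.exp ((-w - w' + w'') / 2));
         0, Complex.exp (-((w + w' + w'') / 2))] := by
  refine ⟨T_inv, ?_⟩
  have h₁ : (w + w' + w'') / 2 = w'' / 2 + w' / 2 + w / 2 := by ring
  have h₂ : (-w + w' + w'') / 2 = w'' / 2 + w' / 2 + -w / 2 := by ring
  have h₃ : (-w - w' + w'') / 2 = w'' / 2 + -w' / 2 + -w / 2 := by ring
  have h₄ : -((w + w' + w'') / 2) = -w'' / 2 + -w' / 2 + -w / 2 := by ring
  rw [T_inv, h₄, h₁, h₂, h₃]
  simp only [Complex.exp_add, T, H]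
  ext i j
  fin_cases i <;> fin_cases j <;> simp [Matrix.mul_apply, Fin.sum_univ_two]
  ring
end

section
/- Let z ∈ ℂ with z ≠ 0 and z ≠ 1, and let w, w', w'' ∈ ℂ satisfy w + w' + w'' = 0, exp(w) = −z, exp(w') = −1/(1−z), and exp(w'') = −(z−1)/z. Then H(w'')·T·H(w')·T·H(w)·T = I. (Cocycle condition around a boundary hexagon in a tetrahedron with all three parity parameters δ = δ' = δ'' = 1 and all faces co-oriented outwards.) -/
open Matrix

/-- The product of matrices around a boundary hexagon is unipotent upper triangular. -/
theorem H_mul_T_mul_three (w w' w'' : ℂ) (hsum : w + w' + w'' = 0) :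
    H w'' * T * H w' * T * H w * T =
      !![1, -(1 + (Complex.exp w)⁻¹ + Complex.exp w''); 0, 1] := by
  have h1 : w / 2 = -(w' / 2 + w'' / 2) := by linear_combination hsum / 2
  have h2 : Complex.exp w = (Complex.exp (w' / 2) * Complex.exp (w'' / 2))⁻¹ ^ 2 := by
    rw [← Complex.exp_add, ← Complex.exp_neg, ← Complex.exp_nat_mul, ← h1]
    congr 1
    push_cast
    ring
  have h3 : Complex.exp w'' = Complex.exp (w'' / 2) ^ 2 := by
    rw [← Complex.exp_nat_mul]
    congr 1
    push_cast
    ring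
  have hb := Complex.exp_ne_zero (w' / 2)
  have hc := Complex.exp_ne_zero (w'' / 2)
  rw [h2, h3]
  simp only [H, T, neg_div, h1, Complex.exp_neg, Complex.exp_add]
  ext i j
  fin_cases i <;> fin_cases j <;> simp [Matrix.mul_apply, Fin.sum_univ_two] <;>
    field_simp <;> ring

/-- Cocycle condition around a boundary hexagon in a tetrahedron with all three parity
parameters equal to `1` and all faces co-oriented outwards. -/
theorem boundary_hexagon_cocycle_all_odd (z w w' w'' : ℂ)
    (hz0 : z ≠ 0) (hz1 : z ≠ 1)
    (hsum : w + w' + w'' = 0)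
    (hw : Complex.exp w = -z)
    (hw' : Complex.exp w' = -(1 / (1 - z)))
    (hw'' : Complex.exp w'' = -((z - 1) / z)) :
    H w'' * T * H w' * T * H w * T = (1 : Matrix (Fin 2) (Fin 2) ℂ) := by
  have h : 1 + (Complex.exp w)⁻¹ + Complex.exp w'' = 0 := by
    rw [hw, hw'']
    field_simp
    ring
  rw [H_mul_T_mul_three w w' w'' hsum, h, neg_zero, Matrix.one_fin_two]
end

section
/- Let z ∈ ℂ with z ≠ 0 and z ≠ 1, and let w, w', w'' ∈ ℂ satisfy w + w' + w'' = 0, exp(w) = −z, exp(w') = −1/(1−z), and exp(w'') = −(z−1)/z. Then H(−w)·T·H(−w')·T·H(−w'')·T = I. (Cocycle condition around a boundary hexagon in a tetrahedron with all three parity parameters equal to 1 and all faces co-oriented inwards.) -/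
open Matrix

/-- Cocycle condition around a boundary hexagon in a tetrahedron with all three parity
parameters equal to `1` and all faces co-oriented inwards. -/
theorem boundary_hexagon_cocycle_all_odd_inward (z w w' w'' : ℂ)
    (hz0 : z ≠ 0) (hz1 : z ≠ 1)
    (hsum : w + w' + w'' = 0)
    (hw : Complex.exp w = -z)
    (hw' : Complex.exp w' = -(1 / (1 - z)))
    (hw'' : Complex.exp w'' = -((z - 1) / z)) :
    H (-w) * T * H (-w') * T * H (-w'') * T = (1 : Matrix (Fin 2) (Fin 2) ℂ) := by
  have hprod : Complex.exp (-w / 2) * Complex.exp (-w' / 2) * Complex.exp (-w'' / 2) = 1 := by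
    rw [← Complex.exp_add, ← Complex.exp_add, ← Complex.exp_zero]
    congr 1
    linear_combination (-1 / 2) * hsum
  have hprod_inv :
      Complex.exp (w / 2) * Complex.exp (w' / 2) * Complex.exp (w'' / 2) = 1 := by
    rw [← Complex.exp_add, ← Complex.exp_add, ← Complex.exp_zero]
    congr 1
    linear_combination (1 / 2) * hsum
  have h_fst : Complex.exp (-w / 2) * Complex.exp (w' / 2) * Complex.exp (w'' / 2) = -(1 / z) := by
    rw [← Complex.exp_add, ← Complex.exp_add,
      show -w / 2 + w' / 2 + w'' / 2 = -w by linear_combination (1 / 2) * hsum,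
      Complex.exp_neg, hw]
    field_simp
  have h_snd : Complex.exp (-w / 2) * Complex.exp (-w' / 2) * Complex.exp (w'' / 2) =
      -((z - 1) / z) := by
    rw [← Complex.exp_add, ← Complex.exp_add,
      show -w / 2 + -w' / 2 + w'' / 2 = w'' by linear_combination (-1 / 2) * hsum, hw'']
  have h_cancel : 1 - (z - 1) / z - 1 / z = 0 := by
    field_simp
    ring
  ext i j
  fin_cases i <;> fin_cases j <;> simp [H, T, Matrix.mul_apply, Fin.sum_univ_two]
  · exact hprod
  · linear_combination -hprod - h_fst - h_snd - h_cancel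
  · exact hprod_inv
end

section
/- Let z ∈ ℂ with z ≠ 0 and z ≠ 1, and let w, w', w'' ∈ ℂ satisfy w + w' + w'' = 0, exp(w) = −z, exp(w') = 1/(1−z), and exp(w'') = (z−1)/z. Then H(w'')·T⁻¹·H(w')·T·H(w)·T = I, where T⁻¹ = [[1,1],[0,1]]. (Cocycle condition around a boundary hexagon in a tetrahedron with parities δ = 1, δ' = δ'' = 0.) -/
open Matrix

/-- Cocycle condition around a boundary hexagon in a tetrahedron with parities
`δ = 1`, `δ' = δ'' = 0`.  Here `T⁻¹ = !![1, 1; 0, 1]`. -/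
theorem boundary_hexagon_cocycle_one_odd (z w w' w'' : ℂ)
    (hz0 : z ≠ 0) (hz1 : z ≠ 1)
    (hsum : w + w' + w'' = 0)
    (hw : Complex.exp w = -z)
    (hw' : Complex.exp w' = 1 / (1 - z))
    (hw'' : Complex.exp w'' = (z - 1) / z) :
    T⁻¹ = !![1, 1; 0, 1] ∧
    H w'' * T⁻¹ * H w' * T * H w * T = (1 : Matrix (Fin 2) (Fin 2) ℂ) := by
  have hT : T⁻¹ = !![1, 1; 0, 1] := by
    apply Matrix.inv_eq_right_inv
    ext i j
    fin_cases i <;> fin_cases j <;> simp [T, Matrix.mul_apply, Fin.sum_univ_two]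
  refine ⟨hT, ?_⟩
  have exp_half_sq (u : ℂ) : Complex.exp (u / 2) ^ 2 = Complex.exp u := by
    rw [← Complex.exp_nat_mul]
    congr 1
    push_cast
    ring
  have exp_neg_half (u : ℂ) : Complex.exp (-u / 2) = (Complex.exp (u / 2))⁻¹ := by
    rw [neg_div, Complex.exp_neg]
  have habc : Complex.exp (w / 2) * Complex.exp (w' / 2) * Complex.exp (w'' / 2) = 1 := by
    rw [← Complex.exp_add, ← Complex.exp_add, ← add_div, ← add_div, hsum]
    simp
  have ha2 := (exp_half_sq w).trans hw
  have hb2 := (exp_half_sq w').trans hw'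
  rw [hT]
  simp only [H, T, exp_neg_half]
  have ha := Complex.exp_ne_zero (w / 2)
  have hb := Complex.exp_ne_zero (w' / 2)
  generalize Complex.exp (w / 2) = a at *
  generalize Complex.exp (w' / 2) = b at *
  generalize Complex.exp (w'' / 2) = c at *
  have hz : 1 - z ≠ 0 := sub_ne_zero.mpr hz1.symm
  have hab : a ^ 2 * b ^ 2 = 1 - b ^ 2 := by
    rw [ha2, hb2]
    field_simp
    ring
  have hentry : (b⁻¹ - b) * a⁻¹ = a * b := by
    field_simp
    linear_combination -hab
  have hinv : c⁻¹ * b⁻¹ * a⁻¹ = 1 := by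
    rw [← mul_inv, ← mul_inv, inv_eq_one]
    linear_combination habc
  ext i j
  fin_cases i <;> fin_cases j <;> simp [Matrix.mul_apply, Fin.sum_univ_two]
  · linear_combination habc
  · linear_combination c * hentry
  · linear_combination hinv
end

section
/- Let z ∈ ℂ with z ≠ 0 and z ≠ 1, and let w, w', w'' ∈ ℂ satisfy w + w' + w'' = 0, exp(w) = −z, exp(w') = 1/(1−z), and exp(w'') = (z−1)/z. Then H(−w')·T⁻¹·H(−w'')·T·H(−w)·T = I, where T⁻¹ = [[1,1],[0,1]]. (Cocycle condition around a boundary hexagon in a tetrahedron with parities δ = 1, δ' = δ'' = 0, with the medium edge orientations reversed.) -/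
open Matrix

/-- Cocycle condition around a boundary hexagon in a tetrahedron with parities
`δ = 1`, `δ' = δ'' = 0`, with the medium edge orientations reversed.  Here `T⁻¹ = !![1, 1; 0, 1]`. -/
theorem boundary_hexagon_cocycle_one_odd_reversed (z w w' w'' : ℂ)
    (hz0 : z ≠ 0) (hz1 : z ≠ 1)
    (hsum : w + w' + w'' = 0)
    (hw : Complex.exp w = -z)
    (hw' : Complex.exp w' = 1 / (1 - z))
    (hw'' : Complex.exp w'' = (z - 1) / z) :
    T⁻¹ = !![1, 1; 0, 1] ∧
    H (-w') * T⁻¹ * H (-w'') * T * H (-w) * T = (1 : Matrix (Fin 2) (Fin 2) ℂ) := by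
  have hT : T⁻¹ = !![1, 1; 0, 1] := by
    refine Matrix.inv_eq_right_inv ?_
    ext i j
    fin_cases i <;> fin_cases j <;> simp [T, Matrix.mul_apply, Fin.sum_univ_two]
  refine ⟨hT, ?_⟩
  have ha : Complex.exp (w / 2) ^ 2 = -z := by
    rw [← Complex.exp_nat_mul, ← hw]
    congr 1
    push_cast
    ring
  have hb : Complex.exp (-w' / 2) ^ 2 = 1 - z := by
    rw [← Complex.exp_nat_mul, ← _root_.inv_inj, ← Complex.exp_neg, ← one_div (1 - z), ← hw']
    congr 1
    push_cast
    ring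
  have hc : Complex.exp (-w'' / 2) = Complex.exp (w / 2) * Complex.exp (w' / 2) := by
    rw [← Complex.exp_add]
    congr 1
    linear_combination -hsum / 2
  have hc' : Complex.exp (w'' / 2) = Complex.exp (-w / 2) * Complex.exp (-w' / 2) := by
    rw [← Complex.exp_add]
    congr 1
    linear_combination hsum / 2
  have haa : Complex.exp (w / 2) * Complex.exp (-w / 2) = 1 := by
    rw [← Complex.exp_add, neg_div, add_neg_cancel, Complex.exp_zero]
  have hbb : Complex.exp (w' / 2) * Complex.exp (-w' / 2) = 1 := by
    rw [← Complex.exp_add, neg_div, add_neg_cancel, Complex.exp_zero]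
  rw [hT]
  simp only [H, T, neg_neg, hc, hc']
  generalize Complex.exp (w / 2) = a at *
  generalize Complex.exp (-w / 2) = a' at *
  generalize Complex.exp (w' / 2) = b at *
  generalize Complex.exp (-w' / 2) = b' at *
  have h00 : b' * (a * b) * a' = 1 := by
    linear_combination b * b' * haa + hbb
  have h11 : b * (a' * b') * a = 1 := by
    linear_combination b * b' * haa + hbb
  have h01 : b' * (a' * b') * a - b' * (a * b) * a - b' * (a * b) * a' = 0 := by
    linear_combination b' ^ 2 * haa + hb - b * b' * ha + z * hbb - h00
  simp only [Matrix.mul_fin_two, Matrix.one_fin_two]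
  ext i j
  fin_cases i <;> fin_cases j <;> simp
  · exact h00
  · linear_combination h01
  · exact h11
end

section
/- Let m, n be natural numbers, let A be an m×n integer matrix, and let 𝕋 = ℝ/ℤ denote the circle group. Let f : 𝕋ⁿ → 𝕋ᵐ be the continuous group homomorphism given by f(x)_i = Σ_j A_{ij}·x_j (integer scalar multiplication in 𝕋). Fix ε ∈ 𝕋ᵐ and suppose the solution set V = {x ∈ 𝕋ⁿ : f(x) = ε} is nonempty. Then every connected component of V (with the subspace topology) is homeomorphic to the torus 𝕋^{n−r}, where r is the rank of A regarded as a matrix over ℚ. (This is the fact, first observed by Luo, that the spaces SA(T) and SA₀(T) of circle-valued angle structures — which are exactly such solution sets of systems of monomial equations on (S¹)^{3N} with right-hand sides ±1 — are disjoint collections of tori of the appropriate dimension.) -/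
open Module Set

/-- A `ℤ`-basis of `ι → ℤ` induces a change of coordinates on `ι → G`. -/
noncomputable def Module.Basis.coordHomeomorph {ι G : Type*} [Fintype ι] [AddCommGroup G]
    [TopologicalSpace G] [IsTopologicalAddGroup G] (b : Basis ι ℤ (ι → ℤ)) :
    (ι → G) ≃ₜ (ι → G) where
  toFun z j := Fintype.linearCombination ℤ z (b j)
  invFun w j := by
    classical exact b.constr ℤ w (Pi.single j 1)
  left_inv z := by
    classical
    have h : b.constr ℤ (fun j ↦ Fintype.linearCombination ℤ z (b j)) =
        Fintype.linearCombination ℤ z := b.ext fun j ↦ by simp only [Basis.constr_basis]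
    ext j
    simp only [h, Fintype.linearCombination_apply_single, one_smul]
  right_inv w := by
    classical
    have h : Fintype.linearCombination ℤ (fun j ↦ b.constr ℤ w (Pi.single j 1)) =
        b.constr ℤ w := by
      refine (Pi.basisFun ℤ ι).ext fun j ↦ ?_
      simp only [Pi.basisFun_apply, Fintype.linearCombination_apply_single, one_smul]
    ext j
    simp only [h, Basis.constr_basis]
  continuous_toFun := by
    simp only [Fintype.linearCombination_apply]
    fun_prop
  continuous_invFun := by
    simp only [Basis.constr_apply_fintype]
    fun_prop

theorem Module.Basis.coordHomeomorph_apply {ι G : Type*} [Fintype ι] [AddCommGroup G]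
    [TopologicalSpace G] [IsTopologicalAddGroup G] (b : Basis ι ℤ (ι → ℤ)) (z : ι → G) (j : ι) :
    b.coordHomeomorph z j = Fintype.linearCombination ℤ z (b j) := rfl

theorem Matrix.rank_map_intCast {m n : Type*} [Fintype m] [Fintype n] (A : Matrix m n ℤ) :
    (A.map (Int.cast : ℤ → ℚ)).rank = finrank ℤ (Submodule.span ℤ (range A.row)) := by
  let φ : (n → ℤ) →ₗ[ℤ] (n → ℚ) := (Algebra.linearMap ℤ ℚ).compLeft n
  have hφ : Function.Injective φ := fun u v h ↦ funext fun j ↦ by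
    simpa [φ] using congrFun h j
  have hrow : range (A.map (Int.cast : ℤ → ℚ)).row = φ '' range A.row := by
    rw [← range_comp]
    rfl
  have : Module.Finite ℤ (Submodule.span ℤ (φ '' range A.row)) :=
    Module.Finite.span_of_finite ℤ ((finite_range _).image _)
  rw [rank_eq_finrank_span_row, hrow, Submodule.finrank_span_eq_finrank_span ℤ,
    ← Submodule.map_span]
  exact (Submodule.equivMapOfInjective φ hφ _).symm.finrank_eq

/-- If a system of integer equations has row span in Smith normal form, it is equivalent to a
diagonal system in the adapted coordinates. -/
theorem Module.Basis.SmithNormalForm.forall_linearCombination_eq_iff {ι κ G : Type*} [Fintype ι]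
    [AddCommGroup G] [TopologicalSpace G] [IsTopologicalAddGroup G] {r : κ → ι → ℤ} {k : ℕ}
    (s : Basis.SmithNormalForm (Submodule.span ℤ (range r)) ι k) (y z : ι → G) :
    (∀ i, Fintype.linearCombination ℤ y (r i) = Fintype.linearCombination ℤ z (r i)) ↔
      ∀ i, s.a i • s.bM.coordHomeomorph y (s.f i) = s.a i • s.bM.coordHomeomorph z (s.f i) := by
  simp only [coordHomeomorph_apply, ← map_smul, ← s.snf]
  constructor
  · intro h i
    exact LinearMap.eqOn_span (by rintro _ ⟨i, rfl⟩; exact h i) (s.bN i).2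
  · intro h i
    have := s.bN.ext (f₁ := (Fintype.linearCombination ℤ y).comp (Submodule.subtype _))
      (f₂ := (Fintype.linearCombination ℤ z).comp (Submodule.subtype _)) h
    exact LinearMap.congr_fun this ⟨r i, Submodule.subset_span (mem_range_self i)⟩

theorem Module.Basis.SmithNormalForm.coeff_ne_zero {ι R M : Type*} [CommRing R] [Nontrivial R]
    [AddCommGroup M] [Module R M] {N : Submodule R M} {k : ℕ} (s : Basis.SmithNormalForm N ι k)
    (i : Fin k) : s.a i ≠ 0 := fun h ↦ s.bN.ne_zero i <| Subtype.ext <| by simp [s.snf, h]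

/-- The functions with prescribed values on `S` are parametrized by their values off `S`. -/
noncomputable def Homeomorph.setOfEqOn {ι X : Type*} [TopologicalSpace X] (S : Set ι)
    (w : ι → X) : {v : ι → X | EqOn v w S} ≃ₜ ((Sᶜ : Set ι) → X) where
  toFun v j := v.1 j
  invFun u := by
    classical
    exact ⟨fun j ↦ if h : j ∈ S then w j else u ⟨j, h⟩, fun j hj ↦ by simp [hj]⟩
  left_inv v := by
    ext j
    by_cases hj : j ∈ S
    · simpa [hj] using (v.2 hj).symm
    · simp [hj]
  right_inv u := by
    ext ⟨j, hj⟩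
    have : j ∉ S := hj
    simp [this]
  continuous_toFun := continuous_pi fun j ↦ (continuous_apply j.1).comp continuous_subtype_val
  continuous_invFun := by
    refine Continuous.subtype_mk (continuous_pi fun j ↦ ?_) _
    by_cases hj : j ∈ S
    · simpa [hj] using continuous_const
    · simpa [hj] using continuous_apply _

theorem connectedComponentIn_eq_setOf_eqOn {ι X : Type*} [TopologicalSpace X]
    [PreconnectedSpace X] {S : Set ι} {F : Set (ι → X)} {w : ι → X}
    (hF : {v | EqOn v w S} ⊆ F)
    (hS : ∀ j ∈ S, IsTotallyDisconnected (Function.eval j '' F)) :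
    connectedComponentIn F w = {v | EqOn v w S} := by
  have hw : w ∈ {v | EqOn v w S} := fun _ _ ↦ rfl
  apply Subset.antisymm
  · intro v hv j hj
    exact hS j hj _ (image_mono (connectedComponentIn_subset F w))
      (isPreconnected_connectedComponentIn.image _ (continuous_apply j).continuousOn)
      (mem_image_of_mem _ hv) (mem_image_of_mem _ (mem_connectedComponentIn (hF hw)))
  · refine IsPreconnected.subset_connectedComponentIn ?_ hw hF
    exact isPreconnected_iff_preconnectedSpace.2
      ((Homeomorph.setOfEqOn S w).symm.surjective.denseRange.preconnectedSpace
        (Homeomorph.setOfEqOn S w).symm.continuous)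

theorem AddCircle.finite_setOf_zsmul_eq (p : ℝ) {a : ℤ} (ha : a ≠ 0) (c : AddCircle p) :
    {t : AddCircle p | a • t = c}.Finite := by
  rcases eq_empty_or_nonempty {t : AddCircle p | a • t = c} with h | ⟨t₀, h₀⟩
  · simp [h]
  · refine ((AddCircle.finite_torsion_of_isSMulRegular_int p a
      (IsSMulRegular.of_right_eq_zero_of_smul fun _ ↦ by simp [ha])).image (t₀ + ·)).subset ?_
    intro t ht
    refine ⟨t - t₀, ?_, by simp⟩
    rw [mem_ofPred_eq] at h₀ ht ⊢
    rw [smul_sub, h₀, ht, sub_self]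

/-- Each connected component of a nonempty solution set of a system of linear
equations over the circle group `𝕋 = ℝ/ℤ` given by an integer matrix `A` is a torus
of dimension `n - rank A` (rank over `ℚ`). -/
theorem connected_components_are_tori
    (m n : ℕ) (A : Matrix (Fin m) (Fin n) ℤ)
    (f : (Fin n → AddCircle (1 : ℝ)) → (Fin m → AddCircle (1 : ℝ)))
    (hf : ∀ x i, f x i = ∑ j, A i j • x j)
    (ε : Fin m → AddCircle (1 : ℝ))
    (V : Set (Fin n → AddCircle (1 : ℝ)))
    (hV : V = {x | f x = ε})
    (hne : V.Nonempty)
    (x : V) :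
    Nonempty ((connectedComponent x) ≃ₜ
      (Fin (n - (A.map (Int.cast : ℤ → ℚ)).rank) → AddCircle (1 : ℝ))) := by
  classical
  obtain ⟨k, s⟩ := Submodule.smithNormalForm (Pi.basisFun ℤ (Fin n))
    (Submodule.span ℤ (range A.row))
  let Φ : (Fin n → AddCircle (1 : ℝ)) ≃ₜ (Fin n → AddCircle (1 : ℝ)) := s.bM.coordHomeomorph
  have hmem (y) : y ∈ V ↔ f y = ε := by rw [hV, mem_ofPred_eq]
  have hΦV : Φ '' V = {w | ∀ i, s.a i • w (s.f i) = s.a i • Φ x (s.f i)} := by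
    ext w
    obtain ⟨y, rfl⟩ := Φ.surjective w
    rw [Φ.injective.mem_set_image, mem_ofPred_eq, ← s.forall_linearCombination_eq_iff, hmem,
      ← (hmem x).1 x.2, funext_iff]
    simp only [hf]
    rfl
  have hcomp : Φ '' connectedComponentIn V x = {w | EqOn w (Φ x) (range s.f)} := by
    rw [Φ.image_connectedComponentIn x.2]
    apply connectedComponentIn_eq_setOf_eqOn
    · intro w hw
      rw [hΦV]
      exact fun i ↦ congrArg _ (hw (mem_range_self i))
    · rintro _ ⟨i, rfl⟩
      refine ((AddCircle.finite_setOf_zsmul_eq 1 (s.coeff_ne_zero i)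
        (s.a i • Φ x (s.f i))).subset ?_).countable.isTotallyDisconnected
      rw [hΦV]
      rintro _ ⟨w, hw, rfl⟩
      exact hw i
  have hcard : Fintype.card ((range s.f)ᶜ : Set (Fin n)) =
      n - (A.map (Int.cast : ℤ → ℚ)).rank := by
    rw [A.rank_map_intCast, finrank_eq_card_basis s.bN, Fintype.card_compl_set,
      card_range_of_injective s.f.injective, Fintype.card_fin]
  have himage : Subtype.val '' connectedComponent x = connectedComponentIn V x :=
    (connectedComponentIn_eq_image x.2).symm
  exact ⟨(Topology.IsEmbedding.subtypeVal.homeomorphImage _).trans <|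
    (Homeomorph.setCongr himage).trans <| (Φ.image _).trans <|
    (Homeomorph.setCongr hcomp).trans <| (Homeomorph.setOfEqOn _ _).trans <|
    Homeomorph.piCongrLeft (Y := fun _ ↦ AddCircle (1 : ℝ)) (Fintype.equivFinOfCardEq hcard)⟩
end

section
/- Let m, n be natural numbers, let A be an m×n integer matrix, and let 𝕋 = ℝ/ℤ denote the circle group. Let f : 𝕋ⁿ → 𝕋ᵐ be the continuous group homomorphism given by f(x)_i = Σ_j A_{ij}·x_j. Fix ε ∈ 𝕋ᵐ and suppose the solution set V = {x ∈ 𝕋ⁿ : f(x) = ε} is nonempty. Then the set of connected components of V is finite, and its cardinality equals the cardinality of the torsion subgroup of the quotient group ℤⁿ / R, where R ⊆ ℤⁿ is the subgroup generated by the rows of A. (Equivalently, the number of connected components equals the product of the absolute values of the nonzero diagonal entries m_j obtained by reducing the system to Smith normal form, which is the paper's method for counting the components of the spaces SA(T) and SA₀(T) of circle-valued angle structures.) -/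
section ConnectedComponents

/-- Homeomorphic spaces have equivalent sets of connected components. -/
def Homeomorph.connectedComponentsEquiv {X Y : Type*} [TopologicalSpace X] [TopologicalSpace Y]
    (e : X ≃ₜ Y) : ConnectedComponents X ≃ ConnectedComponents Y where
  toFun := e.continuous.connectedComponentsMap
  invFun := e.symm.continuous.connectedComponentsMap
  left_inv x := by
    obtain ⟨x, rfl⟩ := ConnectedComponents.surjective_coe x
    simp [Continuous.connectedComponentsMap_mk]
  right_inv x := by
    obtain ⟨x, rfl⟩ := ConnectedComponents.surjective_coe x
    simp [Continuous.connectedComponentsMap_mk]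

/-- The connected components of a product are the products of connected components. -/
theorem ConnectedComponents.nonempty_equiv_pi {ι : Type*} (X : ι → Type*)
    [∀ i, TopologicalSpace (X i)] :
    Nonempty (ConnectedComponents (∀ i, X i) ≃ ∀ i, ConnectedComponents (X i)) := by
  have hc : Continuous fun (x : ∀ i, X i) i ↦ ConnectedComponents.mk (x i) :=
    continuous_pi fun i ↦ ConnectedComponents.continuous_coe.comp (continuous_apply i)
  refine ⟨Equiv.ofBijective hc.connectedComponentsLift ⟨fun x y h ↦ ?_, fun y ↦ ?_⟩⟩
  · obtain ⟨x, rfl⟩ := ConnectedComponents.surjective_coe x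
    obtain ⟨y, rfl⟩ := ConnectedComponents.surjective_coe y
    have hxy (i : ι) : x i ∈ connectedComponent (y i) :=
      ConnectedComponents.coe_eq_coe'.1 (congrFun h i)
    refine ConnectedComponents.coe_eq_coe'.2 ?_
    exact (isPreconnected_univ_pi fun i ↦
      (isPreconnected_connectedComponent (x := y i))).subset_connectedComponent
      (fun i _ ↦ mem_connectedComponent) (fun i _ ↦ hxy i)
  · choose x hx using fun i ↦ ConnectedComponents.surjective_coe (y i)
    exact ⟨ConnectedComponents.mk x, funext hx⟩

/-- In a totally disconnected space every connected component is a point. -/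
theorem ConnectedComponents.mk_bijective {X : Type*} [TopologicalSpace X]
    [TotallyDisconnectedSpace X] :
    Function.Bijective (ConnectedComponents.mk : X → ConnectedComponents X) :=
  ⟨fun x y h ↦ by simpa using ConnectedComponents.coe_eq_coe'.1 h,
    ConnectedComponents.surjective_coe⟩

end ConnectedComponents

section Torsion

/-- The `d`-torsion of the unit circle is `ZMod d`. -/
theorem UnitAddCircle.card_nsmul_eq_zero (d : ℕ) [NeZero d] :
    Nat.card {t : AddCircle (1 : ℝ) | d • t = 0} = d := by
  have hr : Set.range (ZMod.toAddCircle : ZMod d →+ UnitAddCircle) =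
      {t : AddCircle (1 : ℝ) | d • t = 0} := by
    ext t
    constructor
    · rintro ⟨k, rfl⟩
      simp [← map_nsmul]
    · intro ht
      obtain ⟨m, -, hm⟩ := (AddCircle.nsmul_eq_zero_iff (NeZero.pos d)).1 ht
      refine ⟨(m : ZMod d), ?_⟩
      rw [ZMod.toAddCircle_natCast, ← hm, mul_one]
  rw [← hr, Nat.card_range_of_injective (ZMod.toAddCircle_injective d), Nat.card_zmod]

/-- The `d`-torsion of the unit circle has as many connected components as `ZMod d` has torsion
elements (both numbers are `1` for `d = 0`). -/
theorem UnitAddCircle.connectedComponents_nsmul_eq_zero (d : ℕ) :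
    Finite (ConnectedComponents {t : AddCircle (1 : ℝ) | d • t = 0}) ∧
    Nat.card (ConnectedComponents {t : AddCircle (1 : ℝ) | d • t = 0}) =
      Nat.card (AddCommGroup.torsion (ZMod d)) := by
  rcases eq_or_ne d 0 with rfl | hd
  · have huniv : {t : AddCircle (1 : ℝ) | (0 : ℕ) • t = 0} = Set.univ := by simp
    have htors : AddCommGroup.torsion (ZMod 0) = ⊥ :=
      AddCommGroup.isAddTorsionFree_iff_torsion_eq_bot.1 (inferInstanceAs (IsAddTorsionFree ℤ))
    have : ConnectedSpace {t : AddCircle (1 : ℝ) | (0 : ℕ) • t = 0} := by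
      rw [huniv]
      exact isConnected_iff_connectedSpace.1 isConnected_univ
    refine ⟨inferInstance, ?_⟩
    rw [htors, Nat.card_unique, Nat.card_unique]
  · have : NeZero d := ⟨hd⟩
    have hfin : Finite {t : AddCircle (1 : ℝ) | d • t = 0} :=
      Nat.finite_of_card_ne_zero (by rwa [UnitAddCircle.card_nsmul_eq_zero])
    have htors : AddCommGroup.torsion (ZMod d) = ⊤ :=
      AddCommGroup.torsion_eq_top_iff.2 isAddTorsion_of_finite
    let e := Equiv.ofBijective _
      (ConnectedComponents.mk_bijective (X := {t : AddCircle (1 : ℝ) | d • t = 0}))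
    refine ⟨Finite.of_equiv _ e, ?_⟩
    rw [← Nat.card_congr e, UnitAddCircle.card_nsmul_eq_zero, htors, AddSubgroup.card_top,
      Nat.card_zmod]

/-- The torsion subgroup of a finite product is the product of the torsion subgroups. -/
theorem AddCommGroup.mem_torsion_pi {ι : Type*} [Finite ι] {G : ι → Type*}
    [∀ i, AddCommGroup (G i)] (x : ∀ i, G i) :
    x ∈ AddCommGroup.torsion (∀ i, G i) ↔ ∀ i, x i ∈ AddCommGroup.torsion (G i) := by
  cases nonempty_fintype ι
  simp only [AddCommGroup.mem_torsion, isOfFinAddOrder_iff_nsmul_eq_zero]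
  constructor
  · rintro ⟨n, hn, h⟩ i
    exact ⟨n, hn, congrFun h i⟩
  · intro h
    choose n hn h using h
    refine ⟨∏ i, n i, Finset.prod_pos fun i _ ↦ hn i, funext fun i ↦ ?_⟩
    obtain ⟨k, hk⟩ := Finset.dvd_prod_of_mem n (Finset.mem_univ i)
    rw [Pi.smul_apply, hk, mul_comm, mul_smul, h, smul_zero, Pi.zero_apply]

theorem AddCommGroup.card_torsion_pi {ι : Type*} [Fintype ι] (G : ι → Type*)
    [∀ i, AddCommGroup (G i)] :
    Nat.card (AddCommGroup.torsion (∀ i, G i)) =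
      ∏ i, Nat.card (AddCommGroup.torsion (G i)) := by
  rw [← Nat.card_pi]
  exact Nat.card_congr ((Equiv.subtypeEquivRight AddCommGroup.mem_torsion_pi).trans
    Equiv.subtypePiEquivPi)

/-- Isomorphic groups have torsion subgroups of the same cardinality. -/
theorem AddEquiv.card_torsion_eq {G H : Type*} [AddCommGroup G] [AddCommGroup H] (e : G ≃+ H) :
    Nat.card (AddCommGroup.torsion G) = Nat.card (AddCommGroup.torsion H) := by
  rw [← e.map_torsion]
  exact Nat.card_congr (e.toEquiv.image _)

end Torsion

section Lattice

variable {ι : Type*} [Finite ι]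

/-- In coordinates with respect to a suitable basis, a subgroup of a lattice is given by
divisibility conditions on the coordinates. -/
theorem AddSubgroup.exists_basis_mem_iff_dvd {M : Type*} [AddCommGroup M] (b₀ : Module.Basis ι ℤ M)
    (R : AddSubgroup M) :
    ∃ (b : Module.Basis ι ℤ M) (d : ι → ℕ), ∀ r, r ∈ R ↔ ∀ j, (d j : ℤ) ∣ b.repr r j := by
  classical
  cases nonempty_fintype ι
  obtain ⟨k, snf⟩ := (AddSubgroup.toIntSubmodule R).smithNormalForm b₀
  let d (j : ι) : ℕ := if h : ∃ i, snf.f i = j then (snf.a h.choose).natAbs else 0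
  have hd (i : Fin k) : d (snf.f i) = (snf.a i).natAbs := by
    have h : ∃ i', snf.f i' = snf.f i := ⟨i, rfl⟩
    simp only [d, dif_pos h, snf.f.injective h.choose_spec]
  refine ⟨snf.bM, d, fun r ↦ ⟨fun hr j ↦ ?_, fun hr ↦ ?_⟩⟩
  · by_cases hj : j ∈ Set.range snf.f
    · obtain ⟨i, rfl⟩ := hj
      have := snf.repr_apply_embedding_eq_repr_smul ⟨r, hr⟩ (i := i)
      simp only [map_smul, Finsupp.smul_apply, smul_eq_mul] at this
      rw [hd, Int.natAbs_dvd, this]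
      exact dvd_mul_right _ _
    · have := snf.repr_eq_zero_of_notMem_range ⟨r, hr⟩ hj
      simp only at this
      rw [this]
      exact dvd_zero _
  · change r ∈ AddSubgroup.toIntSubmodule R
    rw [← snf.bM.sum_repr r]
    refine Submodule.sum_mem _ fun j _ ↦ ?_
    by_cases hj : j ∈ Set.range snf.f
    · obtain ⟨i, rfl⟩ := hj
      obtain ⟨c, hc⟩ := Int.natAbs_dvd.1 (hd i ▸ hr (snf.f i))
      rw [hc, mul_comm, mul_smul, ← snf.snf]
      exact Submodule.smul_mem _ _ (snf.bN i).2
    · have h0 : d j = 0 := dif_neg hj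
      have := hr j
      rw [h0, Nat.cast_zero, zero_dvd_iff] at this
      rw [this, zero_smul]
      exact Submodule.zero_mem _

/-- The quotient of a lattice by a subgroup given by divisibility conditions. -/
theorem AddSubgroup.nonempty_quotient_equiv_pi_zmod {M : Type*} [AddCommGroup M]
    (b : Module.Basis ι ℤ M) (d : ι → ℕ) (R : AddSubgroup M)
    (hR : ∀ r, r ∈ R ↔ ∀ j, (d j : ℤ) ∣ b.repr r j) :
    Nonempty (M ⧸ R ≃+ ∀ j, ZMod (d j)) := by
  let φ : M →+ ∀ j, ZMod (d j) :=
    (AddMonoidHom.pi fun j ↦ (Int.castAddHom (ZMod (d j))).comp (Pi.evalAddMonoidHom _ j)).comp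
      b.equivFun.toAddMonoidHom
  have hφ (r : M) (j : ι) : φ r j = (b.repr r j : ZMod (d j)) := rfl
  have hker : R = φ.ker := by
    ext r
    rw [hR, AddMonoidHom.mem_ker, funext_iff]
    simp only [hφ, Pi.zero_apply, ZMod.intCast_zmod_eq_zero_iff_dvd]
  have hsurj : Function.Surjective φ := fun y ↦ by
    choose z hz using fun j ↦ ZMod.intCast_surjective (y j)
    refine ⟨b.equivFun.symm z, funext fun j ↦ ?_⟩
    rw [hφ, ← b.equivFun_apply, LinearEquiv.apply_symm_apply, hz]
  exact ⟨(QuotientAddGroup.quotientAddEquivOfEq hker).trans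
    (QuotientAddGroup.quotientKerEquivOfSurjective φ hsurj)⟩

end Lattice

section IntegerMatrix

variable {l m n : Type*} [Fintype m] [Fintype n] {T : Type*} [AddCommGroup T]

/-- The homomorphism `Tⁿ → Tᵐ` associated with an `m × n` integer matrix. -/
def Matrix.intSMulHom (A : Matrix l n ℤ) : (n → T) →+ (l → T) where
  toFun x i := ∑ j, A i j • x j
  map_zero' := by ext; simp
  map_add' x y := by ext; simp [Finset.sum_add_distrib]

theorem Matrix.intSMulHom_apply (A : Matrix l n ℤ) (x : n → T) (i : l) :
    A.intSMulHom x i = ∑ j, A i j • x j := rfl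

theorem Matrix.intSMulHom_mul (A : Matrix l m ℤ) (B : Matrix m n ℤ) (x : n → T) :
    (A * B).intSMulHom x = A.intSMulHom (B.intSMulHom x) := by
  ext i
  simp only [Matrix.intSMulHom_apply, Matrix.mul_apply, Finset.sum_smul, Finset.smul_sum, mul_smul]
  exact Finset.sum_comm

theorem Matrix.intSMulHom_one [DecidableEq n] (x : n → T) :
    (1 : Matrix n n ℤ).intSMulHom x = x := by
  ext i
  simp [Matrix.intSMulHom_apply, Matrix.one_apply, ite_smul]

theorem Matrix.continuous_intSMulHom [TopologicalSpace T] [IsTopologicalAddGroup T]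
    (A : Matrix l n ℤ) : Continuous (A.intSMulHom : (n → T) →+ (l → T)) :=
  continuous_pi fun i ↦ continuous_finsetSum _ fun j _ ↦ (continuous_apply j).zsmul (A i j)

/-- The automorphism of `Tⁿ` associated with a basis of `ℤⁿ`. -/
noncomputable def Module.Basis.intSMulHomeomorph [DecidableEq n] [TopologicalSpace T] [IsTopologicalAddGroup T]
    (b : Module.Basis n ℤ (n → ℤ)) : (n → T) ≃ₜ (n → T) where
  toFun := Matrix.intSMulHom (Matrix.of b)
  invFun := Matrix.intSMulHom (b.toMatrix (Pi.basisFun ℤ n)).transpose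
  left_inv x := by
    have h : (Matrix.of b) = ((Pi.basisFun ℤ n).toMatrix b).transpose := by
      ext; simp [Module.Basis.toMatrix_apply]
    rw [← Matrix.intSMulHom_mul, h, ← Matrix.transpose_mul,
      Module.Basis.toMatrix_mul_toMatrix_flip, Matrix.transpose_one, Matrix.intSMulHom_one]
  right_inv x := by
    have h : (Matrix.of b) = ((Pi.basisFun ℤ n).toMatrix b).transpose := by
      ext; simp [Module.Basis.toMatrix_apply]
    rw [← Matrix.intSMulHom_mul, h, ← Matrix.transpose_mul,
      Module.Basis.toMatrix_mul_toMatrix_flip, Matrix.transpose_one, Matrix.intSMulHom_one]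
  continuous_toFun := Matrix.continuous_intSMulHom _
  continuous_invFun := Matrix.continuous_intSMulHom _

/-- In coordinates adapted to the row lattice of `A`, the system `A x = 0` is diagonal. -/
theorem Matrix.intSMulHom_eq_zero_iff (A : Matrix l n ℤ) (b : Module.Basis n ℤ (n → ℤ)) (d : n → ℕ)
    (hR : ∀ r, r ∈ AddSubgroup.closure (Set.range fun i ↦ A i) ↔ ∀ j, (d j : ℤ) ∣ b.repr r j)
    (x : n → T) :
    A.intSMulHom x = 0 ↔ ∀ j, d j • (Matrix.of b).intSMulHom x j = 0 := by
  classical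
  let p : (n → ℤ) →+ T :=
    { toFun := fun r ↦ ∑ j, r j • x j
      map_zero' := by simp
      map_add' := fun r s ↦ by simp [add_smul, Finset.sum_add_distrib] }
  have hp : A.intSMulHom x = 0 ↔ AddSubgroup.closure (Set.range fun i ↦ A i) ≤ p.ker := by
    rw [AddSubgroup.closure_le, Set.range_subset_iff, funext_iff]
    rfl
  have hb (j : n) : (Matrix.of b).intSMulHom x j = p (b j) := rfl
  rw [hp]
  constructor
  · intro h j
    rw [hb, ← map_nsmul]
    refine h ((hR _).2 fun i ↦ ?_)
    rw [map_nsmul, Module.Basis.repr_self, Finsupp.smul_apply, Finsupp.single_apply]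
    split_ifs with hij
    · simp [hij]
    · simp
  · intro h r hr
    rw [AddMonoidHom.mem_ker, ← b.sum_repr r, map_sum]
    refine Finset.sum_eq_zero fun j _ ↦ ?_
    obtain ⟨c, hc⟩ := (hR r).1 hr j
    rw [hc, mul_comm, mul_smul, map_zsmul, natCast_zsmul, map_nsmul, ← hb, h, smul_zero]

end IntegerMatrix


/-- The set of connected components of a nonempty solution set of a system of linear
equations over the circle group `𝕋 = ℝ/ℤ` given by an integer matrix `A` is finite, of
cardinality equal to that of the torsion subgroup of `ℤⁿ / R`, where `R` is the subgroup
generated by the rows of `A`. -/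
theorem card_connected_components_eq_card_torsion
    (m n : ℕ) (A : Matrix (Fin m) (Fin n) ℤ)
    (f : (Fin n → AddCircle (1 : ℝ)) → (Fin m → AddCircle (1 : ℝ)))
    (hf : ∀ x i, f x i = ∑ j, A i j • x j)
    (ε : Fin m → AddCircle (1 : ℝ))
    (V : Set (Fin n → AddCircle (1 : ℝ)))
    (hV : V = {x | f x = ε})
    (hne : V.Nonempty) :
    Finite (ConnectedComponents ↥V) ∧
    Nat.card (ConnectedComponents ↥V) =
      Nat.card (AddCommGroup.torsion
        ((Fin n → ℤ) ⧸ AddSubgroup.closure (Set.range (fun i => A i)))) := by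
  subst hV
  obtain ⟨x₀, hx₀⟩ := hne
  obtain ⟨b, d, hR⟩ := AddSubgroup.exists_basis_mem_iff_dvd (Pi.basisFun ℤ (Fin n))
    (AddSubgroup.closure (Set.range fun i ↦ A i))
  have hfA (x) : f x = A.intSMulHom x := funext fun i ↦ hf x i
  let S (j : Fin n) : Set (AddCircle (1 : ℝ)) := {t | d j • t = 0}
  let Φ := (Homeomorph.subRight x₀).trans b.intSMulHomeomorph
  have hΦ (x) : f x = ε ↔ ∀ j, Φ x j ∈ S j := by
    rw [← show f x₀ = ε from hx₀, hfA, hfA, ← sub_eq_zero, ← map_sub]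
    exact A.intSMulHom_eq_zero_iff b d hR (x - x₀)
  let e : {x | f x = ε} ≃ₜ ∀ j, S j :=
    (Φ.subtype hΦ).trans
      { Equiv.subtypePiEquivPi with
        continuous_toFun := continuous_pi fun j ↦
          ((continuous_apply j).comp continuous_subtype_val).subtype_mk _
        continuous_invFun := (continuous_pi fun j ↦
          continuous_subtype_val.comp (continuous_apply j)).subtype_mk _ }
  obtain ⟨eπ⟩ := ConnectedComponents.nonempty_equiv_pi fun j ↦ S j
  obtain ⟨eQ⟩ := AddSubgroup.nonempty_quotient_equiv_pi_zmod b d _ hR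
  have hS (j) := UnitAddCircle.connectedComponents_nsmul_eq_zero (d j)
  have hfin (j) : Finite (ConnectedComponents (S j)) := (hS j).1
  refine ⟨Finite.of_equiv _ (e.connectedComponentsEquiv.trans eπ).symm, ?_⟩
  rw [Nat.card_congr (e.connectedComponentsEquiv.trans eπ), Nat.card_pi, eQ.card_torsion_eq,
    AddCommGroup.card_torsion_pi]
  exact Finset.prod_congr rfl fun j _ ↦ (hS j).2
end
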